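/- Let β ∈ (0,2], μ ∈ (1/2,1] and s ≥ −1. There exists a constant c = c(β,μ) > 0 such that for every measurable function G : ℝⁿ × ℝⁿ → ℂ, the function U(t,k,ξ) = G(k,ξ+tk) e_β(t,k,ξ) satisfies ∫_{ℝ^{2n}} ω_β(k,ξ)^{2(s+1/2−(1−μ))} |G(k,ξ)|² dk dξ ≤ c ∫₀^∞ ∫_{ℝ^{2n}} t^{2−2μ} ω_β(k,ξ)^{2(s+1)} |U(t,k,ξ)|² dk dξ dt. -/

import Mathlib

open MeasureTheory Set Filter
open scoped ENNReal

noncomputable section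

/-- `ℝⁿ` with the Euclidean norm. -/
abbrev En (n : ℕ) : Type := EuclideanSpace ℝ (Fin n)

/-- `e_β(t,k,ξ) = exp(−∫₀ᵗ ‖ξ + σ k‖^β dσ)`. -/
def eB (n : ℕ) (β t : ℝ) (k ξ : En n) : ℝ :=
  Real.exp (-(∫ σ in (0:ℝ)..t, ‖ξ + σ • k‖ ^ β))

/-- `ω_β(k,ξ) = 1 + ‖k‖^{β/(β+1)} + ‖ξ‖^β`. -/
def omegaB (n : ℕ) (β : ℝ) (k ξ : En n) : ℝ := 1 + ‖k‖ ^ (β / (β + 1)) + ‖ξ‖ ^ β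

lemma one_le_omegaB (n : ℕ) (β : ℝ) (k ξ : En n) : 1 ≤ omegaB n β k ξ := by
  have h1 := Real.rpow_nonneg (norm_nonneg k) (β / (β + 1))
  have h2 := Real.rpow_nonneg (norm_nonneg ξ) β
  unfold omegaB
  linarith

lemma norm_rpow_le_omegaB (n : ℕ) (β : ℝ) (k ξ : En n) : ‖ξ‖ ^ β ≤ omegaB n β k ξ := by
  have h1 := Real.rpow_nonneg (norm_nonneg k) (β / (β + 1))
  unfold omegaB
  linarith

lemma norm_right_le_omegaB_rpow (n : ℕ) {β : ℝ} (hβ : 0 < β) (k ξ : En n) :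
    ‖ξ‖ ≤ omegaB n β k ξ ^ (1 / β) := by
  have h := Real.rpow_le_rpow (Real.rpow_nonneg (norm_nonneg ξ) β)
    (norm_rpow_le_omegaB n β k ξ) (by positivity : (0:ℝ) ≤ 1 / β)
  rwa [← Real.rpow_mul (norm_nonneg ξ), mul_one_div_cancel hβ.ne', Real.rpow_one] at h

lemma norm_left_le_omegaB_mul (n : ℕ) {β : ℝ} (hβ : 0 < β) (k ξ : En n) :
    ‖k‖ ≤ omegaB n β k ξ * omegaB n β k ξ ^ (1 / β) := by
  have hω : 0 < omegaB n β k ξ := zero_lt_one.trans_le (one_le_omegaB n β k ξ)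
  have h0 : ‖k‖ ^ (β / (β + 1)) ≤ omegaB n β k ξ := by
    have h2 := Real.rpow_nonneg (norm_nonneg ξ) β
    unfold omegaB
    linarith
  have h := Real.rpow_le_rpow (Real.rpow_nonneg (norm_nonneg k) _) h0
    (by positivity : (0:ℝ) ≤ 1 + 1 / β)
  rw [← Real.rpow_mul (norm_nonneg k),
    show β / (β + 1) * (1 + 1 / β) = 1 by field_simp, Real.rpow_one] at h
  rwa [Real.rpow_add hω, Real.rpow_one] at h

lemma exp_neg_le_eB_sq (n : ℕ) {β : ℝ} (hβ : 0 < β) {t D : ℝ} (ht : 0 ≤ t) (k η : En n)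
    (hD : (‖η‖ + t * ‖k‖) ^ β * t ≤ D) :
    Real.exp (-(2 * D)) ≤ eB n β t k (η - t • k) ^ 2 := by
  have h : ‖∫ σ in (0:ℝ)..t, ‖(η - t • k) + σ • k‖ ^ β‖ ≤
      (‖η‖ + t * ‖k‖) ^ β * |t - 0| := by
    apply intervalIntegral.norm_integral_le_of_norm_le_const
    intro σ hσ
    rw [uIoc_of_le ht] at hσ
    rw [Real.norm_of_nonneg (by positivity)]
    apply Real.rpow_le_rpow (norm_nonneg _) _ hβ.le
    calc ‖(η - t • k) + σ • k‖ = ‖η - (t - σ) • k‖ := by congr 1; module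
      _ ≤ ‖η‖ + ‖(t - σ) • k‖ := norm_sub_le _ _
      _ ≤ ‖η‖ + t * ‖k‖ := by
        rw [norm_smul, Real.norm_of_nonneg (by linarith [hσ.2])]
        gcongr
        linarith [hσ.1]
  rw [sub_zero, abs_of_nonneg ht] at h
  have h' := (le_abs_self _).trans (h.trans hD)
  rw [eB, ← Real.exp_nat_mul]
  apply Real.exp_le_exp.2
  push_cast
  linarith

lemma continuous_eB (n : ℕ) {β : ℝ} (hβ : 0 < β) :
    Continuous fun p : ℝ × En n × En n => eB n β p.1 p.2.1 p.2.2 := by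
  unfold eB
  refine Real.continuous_exp.comp (Continuous.neg ?_)
  refine intervalIntegral.continuous_parametric_intervalIntegral_of_continuous
    (f := fun (p : ℝ × En n × En n) (σ : ℝ) => ‖p.2.2 + σ • p.2.1‖ ^ β) ?_ continuous_fst
  exact Continuous.rpow_const (by fun_prop) fun _ => Or.inr hβ.le

lemma continuous_omegaB (n : ℕ) {β : ℝ} (hβ : 0 < β) :
    Continuous fun p : En n × En n => omegaB n β p.1 p.2 := by
  unfold omegaB
  refine (continuous_const.add (Continuous.rpow_const (by fun_prop) fun _ => Or.inr ?_)).add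
    (Continuous.rpow_const (by fun_prop) fun _ => Or.inr hβ.le)
  positivity

lemma smul_le_norm_sub_add (n : ℕ) {t : ℝ} (ht : 0 ≤ t) (k η : En n) :
    t * ‖k‖ ≤ ‖η - t • k‖ + ‖η‖ := by
  have h := norm_sub_le η (η - t • k)
  rw [sub_sub_cancel, norm_smul, Real.norm_of_nonneg ht] at h
  linarith

lemma norm_le_norm_sub_smul_add (n : ℕ) {t : ℝ} (ht : 0 ≤ t) (k η : En n) :
    ‖η‖ ≤ ‖η - t • k‖ + t * ‖k‖ := by
  have h := norm_add_le (η - t • k) (t • k)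
  rwa [sub_add_cancel, norm_smul, Real.norm_of_nonneg ht] at h

/-- At times after the line `η - t k` has left the ball of radius `2‖η‖`, the weight exceeds
its initial value by a definite factor. -/
lemma omegaB_mul_two_rpow_le (n : ℕ) {β t : ℝ} (hβ : 0 < β) (ht : 0 ≤ t) (k η : En n)
    (h : 3 * ‖η‖ ≤ t * ‖k‖) :
    omegaB n β k η * 2 ^ (β * (‖η‖ ^ β / omegaB n β k η)) ≤ omegaB n β k (η - t • k) := by
  have hω : 0 < omegaB n β k η := zero_lt_one.trans_le (one_le_omegaB n β k η)
  have h2 : 2 * ‖η‖ ≤ ‖η - t • k‖ := by linarith [smul_le_norm_sub_add n ht k η]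
  have h3 := Real.rpow_le_rpow (by positivity) h2 hβ.le
  rw [Real.mul_rpow (by norm_num) (norm_nonneg _)] at h3
  have h4 := rpow_one_add_le_one_add_mul_self (s := (2:ℝ) ^ β - 1)
    (p := ‖η‖ ^ β / omegaB n β k η) (by linarith [Real.rpow_pos_of_pos two_pos β])
    (by positivity) ((div_le_one hω).2 (norm_rpow_le_omegaB n β k η))
  rw [add_sub_cancel, ← Real.rpow_mul (by norm_num)] at h4
  calc _ ≤ omegaB n β k η * (1 + ‖η‖ ^ β / omegaB n β k η * (2 ^ β - 1)) := by gcongr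
    _ = omegaB n β k η + ‖η‖ ^ β * (2 ^ β - 1) := by field_simp
    _ ≤ _ := by
      unfold omegaB
      linarith

lemma exp_neg_four_mul_le {u : ℝ} (hu : u ≤ 1 / 2) (hu0 : 0 ≤ u) :
    Real.exp (-(4 * u)) ≤ (1 - u) ^ 2 := by
  have h1 : 0 < 1 - u := by linarith
  have h : Real.exp (-(2 * u)) ≤ 1 - u := by
    have h2 : (1 - u)⁻¹ ≤ Real.exp (2 * u) := by
      refine le_trans ?_ (Real.add_one_le_exp _)
      rw [inv_le_iff_one_le_mul₀ h1]
      nlinarith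
    rw [Real.exp_neg]
    exact inv_le_of_inv_le₀ h1 h2
  calc _ = Real.exp (-(2 * u)) ^ 2 := by
        rw [← Real.exp_nat_mul]; congr 1; push_cast; ring
    _ ≤ _ := by gcongr

/-- The weight decreases slowly while `t ‖k‖` is a small fraction of `‖η‖`. -/
lemma omegaB_mul_exp_le (n : ℕ) {β t u : ℝ} (hβ : 0 < β) (hβ2 : β ≤ 2) (ht : 0 ≤ t)
    (k η : En n) (hu0 : 0 ≤ u) (hu : u ≤ 1 / 2) (h : t * ‖k‖ ≤ u * ‖η‖) :
    omegaB n β k η * Real.exp (-(4 * u)) ≤ omegaB n β k (η - t • k) := by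
  have hω : 0 < omegaB n β k η := zero_lt_one.trans_le (one_le_omegaB n β k η)
  have h1 : 0 < 1 - u := by linarith
  have h2 : (1 - u) * ‖η‖ ≤ ‖η - t • k‖ := by
    linarith [norm_le_norm_sub_smul_add n ht k η]
  have h3 := Real.rpow_le_rpow (by positivity) h2 hβ.le
  rw [Real.mul_rpow h1.le (norm_nonneg _)] at h3
  have h4 : (1 - u) ^ 2 ≤ (1 - u) ^ β := by
    rw [← Real.rpow_natCast]
    exact Real.rpow_le_rpow_of_exponent_ge h1 (by linarith) (by exact_mod_cast hβ2)
  have h5 : (1 - u) ^ 2 * ‖η‖ ^ β ≤ (1 - u) ^ β * ‖η‖ ^ β := by gcongr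
  have h6 : (1 - u) ^ 2 ≤ 1 := by nlinarith
  have h7 := Real.rpow_nonneg (norm_nonneg k) (β / (β + 1))
  calc _ ≤ omegaB n β k η * (1 - u) ^ 2 := by gcongr; exact exp_neg_four_mul_le hu hu0
    _ ≤ _ := by
      unfold omegaB
      nlinarith

/-- The exponent in the lower bound for the weighted propagator. -/
def decayConst (β : ℝ) : ℝ := 588 / (β * Real.log 2)

lemma decayConst_pos {β : ℝ} (hβ : 0 < β) : 0 < decayConst β := by
  have := Real.log_pos one_lt_two
  unfold decayConst
  positivity

lemma weighted_bound_of_large_left (n : ℕ) {β a t : ℝ} (hβ : 0 < β) (hβ2 : β ≤ 2) (ha : 0 ≤ a)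
    (k η : En n) (h : 3 * ‖η‖ * omegaB n β k η ≤ ‖k‖)
    (ht : t ∈ Icc (1 / omegaB n β k η) (2 * (1 / omegaB n β k η))) :
    Real.exp (-36) * omegaB n β k η ^ a ≤
      omegaB n β k (η - t • k) ^ a * eB n β t k (η - t • k) ^ 2 := by
  have hω : 0 < omegaB n β k η := zero_lt_one.trans_le (one_le_omegaB n β k η)
  have ht0 : 0 ≤ t := le_trans (by positivity) ht.1
  have hgrow := omegaB_mul_two_rpow_le n hβ ht0 k η (by
    have h1 : 1 ≤ t * omegaB n β k η := (div_le_iff₀ hω).1 ht.1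
    have h2 := mul_le_mul_of_nonneg_left h ht0
    nlinarith [mul_nonneg (norm_nonneg η) (sub_nonneg.2 h1)])
  have hmono : omegaB n β k η ≤ omegaB n β k (η - t • k) := by
    refine le_trans (le_mul_of_one_le_right hω.le ?_) hgrow
    exact Real.one_le_rpow one_le_two (by positivity)
  have ht2 : t * omegaB n β k η ≤ 2 := by
    have := ht.2
    rw [mul_one_div] at this
    exact (le_div_iff₀ hω).1 this
  have hE := exp_neg_le_eB_sq n hβ (D := 18) ht0 k η (by
    have h3 : ‖η‖ + t * ‖k‖ ≤ 3 * omegaB n β k η ^ (1 / β) := by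
      have e1 := norm_right_le_omegaB_rpow n hβ k η
      have e2 := mul_le_mul_of_nonneg_left (norm_left_le_omegaB_mul n hβ k η) ht0
      have e3 : 0 ≤ omegaB n β k η ^ (1 / β) := by positivity
      nlinarith [mul_le_mul_of_nonneg_right ht2 e3]
    have h4 := Real.rpow_le_rpow (by positivity) h3 hβ.le
    rw [Real.mul_rpow (by norm_num) (by positivity), ← Real.rpow_mul hω.le,
      one_div_mul_cancel hβ.ne', Real.rpow_one] at h4
    have h5 : (3:ℝ) ^ β ≤ 3 ^ (2:ℝ) := Real.rpow_le_rpow_of_exponent_le (by norm_num) hβ2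
    norm_num at h5
    calc _ ≤ (3 ^ β * omegaB n β k η) * t := by gcongr
      _ = 3 ^ β * (t * omegaB n β k η) := by ring
      _ ≤ 9 * 2 := by gcongr
      _ = 18 := by norm_num)
  norm_num at hE
  have hω' := zero_lt_one.trans_le (one_le_omegaB n β k (η - t • k))
  rw [mul_comm]
  gcongr

lemma weighted_bound_of_large_exponent (n : ℕ) {β a t : ℝ} (hβ : 0 < β) (hβ2 : β ≤ 2)
    (ha : 0 ≤ a) (k η : En n) (hk : 0 < ‖k‖)
    (h : decayConst β * (‖η‖ * omegaB n β k η) ≤ a * ‖k‖)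
    (ht : t ∈ Icc (3 * ‖η‖ / ‖k‖) (2 * (3 * ‖η‖ / ‖k‖))) :
    omegaB n β k η ^ a ≤
      omegaB n β k (η - t • k) ^ a * eB n β t k (η - t • k) ^ 2 := by
  have hω : 0 < omegaB n β k η := zero_lt_one.trans_le (one_le_omegaB n β k η)
  have hω' := zero_lt_one.trans_le (one_le_omegaB n β k (η - t • k))
  have ht0 : 0 ≤ t := le_trans (by positivity) ht.1
  have hgrow := omegaB_mul_two_rpow_le n hβ ht0 k η ((div_le_iff₀ hk).1 ht.1)
  have hgrow' := Real.rpow_le_rpow (by positivity) hgrow ha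
  rw [Real.mul_rpow hω.le (by positivity), ← Real.rpow_mul (by norm_num)] at hgrow'
  have hl := Real.log_pos one_lt_two
  have ht2 : t * ‖k‖ ≤ 6 * ‖η‖ := by
    have := ht.2
    rw [← mul_div_assoc, le_div_iff₀ hk] at this
    linarith
  have hE := exp_neg_le_eB_sq n hβ (D := 294 * ‖η‖ ^ β * ‖η‖ / ‖k‖) ht0 k η (by
    have h4 := Real.rpow_le_rpow (by positivity)
      (show ‖η‖ + t * ‖k‖ ≤ 7 * ‖η‖ by linarith) hβ.le
    rw [Real.mul_rpow (by norm_num) (by positivity)] at h4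
    have h5 : (7:ℝ) ^ β ≤ 7 ^ (2:ℝ) := Real.rpow_le_rpow_of_exponent_le (by norm_num) hβ2
    norm_num at h5
    calc _ ≤ (49 * ‖η‖ ^ β) * (6 * ‖η‖ / ‖k‖) := by
          gcongr
          · exact h4.trans (by gcongr)
          · exact (le_div_iff₀ hk).2 ht2
      _ = _ := by ring)
  have hexp : Real.exp (2 * (294 * ‖η‖ ^ β * ‖η‖ / ‖k‖)) ≤
      2 ^ (β * (‖η‖ ^ β / omegaB n β k η) * a) := by
    rw [Real.rpow_def_of_pos two_pos]
    apply Real.exp_le_exp.2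
    have h6 : 588 * (‖η‖ * omegaB n β k η) ≤ a * ‖k‖ * (β * Real.log 2) := by
      have := mul_le_mul_of_nonneg_right h (by positivity : 0 ≤ β * Real.log 2)
      unfold decayConst at this
      have e : 588 / (β * Real.log 2) * (‖η‖ * omegaB n β k η) * (β * Real.log 2) =
        588 * (‖η‖ * omegaB n β k η) := by field_simp
      rwa [e] at this
    rw [show 2 * (294 * ‖η‖ ^ β * ‖η‖ / ‖k‖) = ‖η‖ ^ β * (588 * ‖η‖ / ‖k‖) by ring,
      show Real.log 2 * (β * (‖η‖ ^ β / omegaB n β k η) * a) =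
        ‖η‖ ^ β * (a * (β * Real.log 2) / omegaB n β k η) by ring]
    gcongr ?_ * ?_
    rw [div_le_div_iff₀ hk hω]
    linarith
  calc omegaB n β k η ^ a
      = omegaB n β k η ^ a * Real.exp (2 * (294 * ‖η‖ ^ β * ‖η‖ / ‖k‖)) *
        Real.exp (-(2 * (294 * ‖η‖ ^ β * ‖η‖ / ‖k‖))) := by
        rw [mul_assoc, ← Real.exp_add, add_neg_cancel, Real.exp_zero, mul_one]
    _ ≤ _ := by
        gcongr
        exact le_trans (mul_le_mul_of_nonneg_left hexp (by positivity)) hgrow'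

lemma weighted_bound_of_small_exponent (n : ℕ) {β a t : ℝ} (hβ : 0 < β) (hβ2 : β ≤ 2)
    (ha : 0 ≤ a) (k η : En n) (hk : ‖k‖ ≤ 3 * ‖η‖ * omegaB n β k η)
    (h : a * ‖k‖ ≤ decayConst β * (‖η‖ * omegaB n β k η))
    (ht : t ∈ Icc (1 / (12 * omegaB n β k η)) (2 * (1 / (12 * omegaB n β k η)))) :
    Real.exp (-(decayConst β + 8)) * omegaB n β k η ^ a ≤
      omegaB n β k (η - t • k) ^ a * eB n β t k (η - t • k) ^ 2 := by
  have hω : 0 < omegaB n β k η := zero_lt_one.trans_le (one_le_omegaB n β k η)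
  have hA := decayConst_pos hβ
  have hω' := zero_lt_one.trans_le (one_le_omegaB n β k (η - t • k))
  have ht0 : 0 ≤ t := le_trans (by positivity) ht.1
  have ht2 : t * omegaB n β k η ≤ 1 / 6 := by
    have := mul_le_mul_of_nonneg_right ht.2 hω.le
    refine this.trans_eq ?_
    field_simp
    norm_num
  have htk : t * ‖k‖ ≤ 1 / 2 * ‖η‖ := by
    have := mul_le_mul_of_nonneg_left hk ht0
    nlinarith [mul_le_mul_of_nonneg_right ht2 (norm_nonneg η)]
  have hatk : t * ‖k‖ * a ≤ decayConst β / 6 * ‖η‖ := by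
    have := mul_le_mul_of_nonneg_left h ht0
    nlinarith [mul_le_mul_of_nonneg_right ht2 (mul_nonneg hA.le (norm_nonneg η))]
  have hu : t * ‖k‖ / ‖η‖ ≤ 1 / 2 := div_le_of_le_mul₀ (norm_nonneg _) (by norm_num) htk
  have hua : t * ‖k‖ / ‖η‖ * a ≤ decayConst β / 6 := by
    rw [div_mul_eq_mul_div]
    exact div_le_of_le_mul₀ (norm_nonneg _) (by positivity) hatk
  have hlow := omegaB_mul_exp_le n (u := t * ‖k‖ / ‖η‖) hβ hβ2 ht0 k η (by positivity) hu (by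
    rcases (norm_nonneg η).eq_or_lt with h0 | h0
    · rw [← h0] at htk ⊢
      simpa using htk
    · rw [div_mul_cancel₀ _ h0.ne'])
  have hlow' := Real.rpow_le_rpow (by positivity) hlow ha
  rw [Real.mul_rpow hω.le (by positivity), ← Real.exp_mul] at hlow'
  have hE := exp_neg_le_eB_sq n hβ (D := 4) ht0 k η (by
    have h4 := Real.rpow_le_rpow (by positivity)
      (show ‖η‖ + t * ‖k‖ ≤ 2 * ‖η‖ by linarith [norm_nonneg η]) hβ.le
    rw [Real.mul_rpow (by norm_num) (by positivity)] at h4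
    have h5 : (2:ℝ) ^ β ≤ 2 ^ (2:ℝ) := Real.rpow_le_rpow_of_exponent_le (by norm_num) hβ2
    norm_num at h5
    calc _ ≤ (4 * omegaB n β k η) * t := by
          gcongr
          exact h4.trans (by gcongr; exact norm_rpow_le_omegaB n β k η)
      _ ≤ 4 := by linarith)
  calc Real.exp (-(decayConst β + 8)) * omegaB n β k η ^ a
      = omegaB n β k η ^ a * Real.exp (-decayConst β) * Real.exp (-(2 * 4)) := by
        rw [mul_assoc, ← Real.exp_add, mul_comm]
        congr 2
        ring
    _ ≤ _ := by
        gcongr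
        refine le_trans (mul_le_mul_of_nonneg_left (Real.exp_le_exp.2 ?_) (by positivity)) hlow'
        linarith

/-- Uniformly in the exponent `a`, some dyadic time interval starting no earlier than
`1 / (12 ω)` carries a weight comparable with the initial one. -/
lemma exists_time_weighted_bound (n : ℕ) {β a : ℝ} (hβ : 0 < β) (hβ2 : β ≤ 2) (ha : 0 ≤ a)
    (k η : En n) :
    ∃ T : ℝ, 1 / (12 * omegaB n β k η) ≤ T ∧ ∀ t ∈ Icc T (2 * T),
      Real.exp (-(decayConst β + 36)) * omegaB n β k η ^ a ≤
        omegaB n β k (η - t • k) ^ a * eB n β t k (η - t • k) ^ 2 := by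
  have hω : 0 < omegaB n β k η := zero_lt_one.trans_le (one_le_omegaB n β k η)
  have hA := decayConst_pos hβ
  have h12 : 1 / (12 * omegaB n β k η) ≤ 1 / omegaB n β k η := by
    gcongr
    linarith
  by_cases h1 : 3 * ‖η‖ * omegaB n β k η ≤ ‖k‖
  · refine ⟨_, h12, fun t ht => le_trans ?_ (weighted_bound_of_large_left n hβ hβ2 ha k η h1 ht)⟩
    gcongr
    linarith
  push Not at h1
  by_cases h2 : 0 < ‖k‖ ∧ decayConst β * (‖η‖ * omegaB n β k η) ≤ a * ‖k‖
  · refine ⟨3 * ‖η‖ / ‖k‖, h12.trans ?_, fun t ht =>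
      le_trans ?_ (weighted_bound_of_large_exponent n hβ hβ2 ha k η h2.1 h2.2 ht)⟩
    · rw [div_le_div_iff₀ hω h2.1]
      linarith
    · exact mul_le_of_le_one_left (by positivity) (Real.exp_le_one_iff.2 (by linarith))
  · refine ⟨_, le_rfl, fun t ht => le_trans ?_
      (weighted_bound_of_small_exponent n hβ hβ2 ha k η h1.le ?_ ht)⟩
    · gcongr
      linarith
    · rcases (norm_nonneg k).eq_or_lt with h0 | h0
      · rw [← h0, mul_zero]
        positivity
      · exact (not_le.1 fun h => h2 ⟨h0, h⟩).le

lemma omegaB_rpow_le_lintegral (n : ℕ) {β μ a : ℝ} (hβ : 0 < β) (hβ2 : β ≤ 2) (hμ : μ ≤ 1)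
    (ha : 0 ≤ a) (k η : En n) :
    ENNReal.ofReal (Real.exp (-(decayConst β + 36)) * (1 / 12) ^ (3 - 2 * μ) *
        omegaB n β k η ^ (a - (3 - 2 * μ))) ≤
      ∫⁻ t in Ioi (0:ℝ), ENNReal.ofReal (t ^ (2 - 2 * μ) * omegaB n β k (η - t • k) ^ a *
        eB n β t k (η - t • k) ^ 2) := by
  have hω : 0 < omegaB n β k η := zero_lt_one.trans_le (one_le_omegaB n β k η)
  obtain ⟨T, hT, hb⟩ := exists_time_weighted_bound n hβ hβ2 ha k η
  have hT0 : 0 < T := lt_of_lt_of_le (by positivity) hT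
  calc _ ≤ ENNReal.ofReal (T ^ (2 - 2 * μ) *
          (Real.exp (-(decayConst β + 36)) * omegaB n β k η ^ a) * T) := by
        apply ENNReal.ofReal_le_ofReal
        have h1 : (1 / 12) ^ (3 - 2 * μ) * omegaB n β k η ^ (-(3 - 2 * μ)) ≤
            T ^ (3 - 2 * μ) := by
          refine le_trans (le_of_eq ?_)
            (Real.rpow_le_rpow (by positivity) hT (by linarith : 0 ≤ 3 - 2 * μ))
          rw [Real.rpow_neg hω.le, ← Real.inv_rpow hω.le,
            ← Real.mul_rpow (by norm_num) (by positivity)]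
          congr 1
          field_simp
        have h2 : T ^ (3 - 2 * μ) = T ^ (2 - 2 * μ) * T := by
          rw [← Real.rpow_add_one hT0.ne']
          congr 1
          ring
        rw [sub_eq_add_neg a, Real.rpow_add hω]
        calc _ = Real.exp (-(decayConst β + 36)) * omegaB n β k η ^ a *
              ((1 / 12) ^ (3 - 2 * μ) * omegaB n β k η ^ (-(3 - 2 * μ))) := by ring
          _ ≤ Real.exp (-(decayConst β + 36)) * omegaB n β k η ^ a * T ^ (3 - 2 * μ) := by
            gcongr
          _ = _ := by rw [h2]; ring
    _ = ∫⁻ _ in Icc T (2 * T), ENNReal.ofReal (T ^ (2 - 2 * μ) *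
          (Real.exp (-(decayConst β + 36)) * omegaB n β k η ^ a)) := by
        rw [setLIntegral_const, Real.volume_Icc, ← ENNReal.ofReal_mul (by positivity)]
        congr 2
        ring
    _ ≤ ∫⁻ t in Icc T (2 * T), ENNReal.ofReal (t ^ (2 - 2 * μ) *
          omegaB n β k (η - t • k) ^ a * eB n β t k (η - t • k) ^ 2) := by
        apply setLIntegral_mono' measurableSet_Icc
        intro t ht
        apply ENNReal.ofReal_le_ofReal
        rw [mul_assoc (t ^ (2 - 2 * μ))]
        have ht0 : 0 ≤ t := hT0.le.trans ht.1
        apply mul_le_mul _ (hb t ht) (by positivity) (by positivity)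
        exact Real.rpow_le_rpow hT0.le ht.1 (by linarith)
    _ ≤ _ := lintegral_mono_set fun t ht => hT0.trans_le ht.1

/-- Integrating along free transport: shift `ξ` to `ξ + t k` and exchange the order of
integration. -/
lemma lintegral_transport_swap (n : ℕ) (S : Set ℝ) (H : ℝ → En n → En n → ℝ≥0∞)
    (hH : Measurable fun p : ℝ × En n × En n => H p.1 p.2.1 p.2.2) :
    ∫⁻ t in S, ∫⁻ k : En n, ∫⁻ ξ : En n, H t k (ξ + t • k) =
      ∫⁻ k : En n, ∫⁻ η : En n, ∫⁻ t in S, H t k η := by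
  have h1 : ∀ (t : ℝ) (k : En n), ∫⁻ ξ : En n, H t k (ξ + t • k) = ∫⁻ η : En n, H t k η :=
    fun t k => lintegral_add_right_eq_self (fun η => H t k η) (t • k)
  simp_rw [h1]
  have h2 : ∀ t : ℝ, ∫⁻ k : En n, ∫⁻ η : En n, H t k η =
      ∫⁻ p : En n × En n, H t p.1 p.2 := fun t =>
    (lintegral_prod (μ := (volume : Measure (En n))) (ν := (volume : Measure (En n)))
      (fun p : En n × En n => H t p.1 p.2)
      (hH.comp (measurable_const.prodMk measurable_id)).aemeasurable).symm
  simp_rw [h2]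
  rw [lintegral_lintegral_swap hH.aemeasurable]
  exact lintegral_prod (μ := (volume : Measure (En n))) (ν := (volume : Measure (En n)))
    (fun p : En n × En n => ∫⁻ t in S, H t p.1 p.2)
    (Measurable.lintegral_prod_left' hH).aemeasurable

theorem stmt6 (n : ℕ) (hn : 1 ≤ n) (β μ : ℝ) (hβ : β ∈ Ioc (0:ℝ) 2)
    (hμ : μ ∈ Ioc (1/2 : ℝ) 1) :
    ∃ c : ℝ, 0 < c ∧ ∀ s : ℝ, (-1:ℝ) ≤ s → ∀ G : En n → En n → ℂ,
      Measurable (fun p : En n × En n => G p.1 p.2) →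
      (∫⁻ (k : En n), ∫⁻ (ξ : En n),
          ENNReal.ofReal (omegaB n β k ξ ^ (2 * (s + 1/2 - (1 - μ))) * ‖G k ξ‖ ^ 2))
        ≤ ENNReal.ofReal c *
          ∫⁻ t in Ioi (0:ℝ), ∫⁻ (k : En n), ∫⁻ (ξ : En n),
            ENNReal.ofReal (t ^ (2 - 2*μ) * omegaB n β k ξ ^ (2 * (s + 1)) *
              ‖G k (ξ + t • k) * (eB n β t k ξ : ℂ)‖ ^ 2) := by
  obtain ⟨hβ0, hβ2⟩ := hβ
  set C : ℝ := Real.exp (-(decayConst β + 36)) * (1 / 12) ^ (3 - 2 * μ) with hC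
  have hC0 : 0 < C := by positivity
  refine ⟨C⁻¹, inv_pos.2 hC0, fun s hs G hG => ?_⟩
  have ha : 0 ≤ 2 * (s + 1) := by linarith
  have hωpos : ∀ k ξ : En n, 0 < omegaB n β k ξ := fun k ξ =>
    zero_lt_one.trans_le (one_le_omegaB n β k ξ)
  have hcont : Continuous fun p : ℝ × En n × En n => p.1 ^ (2 - 2 * μ) *
      omegaB n β p.2.1 (p.2.2 - p.1 • p.2.1) ^ (2 * (s + 1)) *
      eB n β p.1 p.2.1 (p.2.2 - p.1 • p.2.1) ^ 2 := by
    refine ((Continuous.rpow_const continuous_fst fun _ => Or.inr (by linarith [hμ.2])).mul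
      (Continuous.rpow_const ?_ fun _ => Or.inr ha)).mul (Continuous.pow ?_ 2)
    · exact (continuous_omegaB n hβ0).comp
        (f := fun p : ℝ × En n × En n => (p.2.1, p.2.2 - p.1 • p.2.1)) (by fun_prop)
    · exact (continuous_eB n hβ0).comp
        (f := fun p : ℝ × En n × En n => (p.1, p.2.1, p.2.2 - p.1 • p.2.1)) (by fun_prop)
  have hGm : Measurable fun p : ℝ × En n × En n => G p.2.1 p.2.2 := hG.comp measurable_snd
  have hswap := lintegral_transport_swap n (Ioi 0) (fun t k η =>
    ENNReal.ofReal (t ^ (2 - 2 * μ) * omegaB n β k (η - t • k) ^ (2 * (s + 1)) *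
      eB n β t k (η - t • k) ^ 2) * ENNReal.ofReal (‖G k η‖ ^ 2))
    (hcont.measurable.ennreal_ofReal.mul (hGm.norm.pow_const 2).ennreal_ofReal)
  have hrhs : (∫⁻ t in Ioi (0:ℝ), ∫⁻ (k : En n), ∫⁻ (ξ : En n),
      ENNReal.ofReal (t ^ (2 - 2*μ) * omegaB n β k ξ ^ (2 * (s + 1)) *
        ‖G k (ξ + t • k) * (eB n β t k ξ : ℂ)‖ ^ 2)) =
      ∫⁻ (k : En n), ∫⁻ (η : En n), ∫⁻ t in Ioi (0:ℝ),
        ENNReal.ofReal (t ^ (2 - 2 * μ) * omegaB n β k (η - t • k) ^ (2 * (s + 1)) *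
          eB n β t k (η - t • k) ^ 2) * ENNReal.ofReal (‖G k η‖ ^ 2) := by
    rw [← hswap]
    refine lintegral_congr fun t => lintegral_congr fun k => lintegral_congr fun ξ => ?_
    rw [← ENNReal.ofReal_mul' (by positivity), add_sub_cancel_right, norm_mul,
      Complex.norm_real, mul_pow, Real.norm_eq_abs, sq_abs]
    congr 1
    ring
  rw [hrhs, ← lintegral_const_mul' _ _ ENNReal.ofReal_ne_top]
  refine lintegral_mono fun k => ?_
  rw [← lintegral_const_mul' _ _ ENNReal.ofReal_ne_top]
  refine lintegral_mono fun η => ?_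
  rw [lintegral_mul_const' _ _ ENNReal.ofReal_ne_top, ← mul_assoc,
    ENNReal.ofReal_mul (Real.rpow_nonneg (hωpos k η).le _)]
  gcongr
  refine le_trans ?_ (mul_le_mul_right
    (omegaB_rpow_le_lintegral n hβ0 hβ2 hμ.2 ha k η) _)
  rw [← hC, ← ENNReal.ofReal_mul (inv_pos.2 hC0).le, inv_mul_cancel_left₀ hC0.ne']
  apply le_of_eq
  congr 2
  ring
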